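/- Let X* be a real random variable on a probability space, x̄ ∈ ℝ, and p := ℙ(X* ≤ x̄) > 0. Suppose the law of X* admits a density f with respect to Lebesgue measure that is continuous and strictly positive on an open interval J containing x̄. Let s : ℝ → ℝ be measurable, continuously differentiable on J with s(x̄) = 0, k := s'(x̄) ≠ 0, and s' nonvanishing on J; set θ := sgn(k). Assume θ·s(x) < 0 for every x < x̄, and that there exists δ > 0 such that every x ≤ x̄ with |s(x)| < δ lies in J. Define the conditional CDF G(t) := ℙ({s(X*) ≤ t} ∩ {X* ≤ x̄})/p. Then: if k > 0, the left derivative g₀ := lim_{h → 0⁻} (G(h) − G(0))/h exists and equals f(x̄)/(p·k); if k < 0, the right derivative g₀ := lim_{h → 0⁺} (G(h) − G(0))/h exists and equals f(x̄)/(p·|k|). In either case |s'(x̄)| = (f(x̄)/p)/g₀. -/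

import Mathlib

open Filter Set Topology MeasureTheory

/-- If a finite measure has a Lebesgue density that is continuous on an open interval, then its
distribution function is differentiable there, with derivative the density. -/
theorem hasDerivAt_real_Iic_of_withDensity {μ : Measure ℝ} [IsFiniteMeasure μ] {f : ℝ → ℝ}
    (hμ : μ = volume.withDensity fun x => ENNReal.ofReal (f x)) {a b c : ℝ}
    (hc : c ∈ Ioo a b) (hf : ContinuousOn f (Ioo a b)) (hf0 : ∀ x ∈ Ioo a b, 0 < f x) :
    HasDerivAt (fun x => μ.real (Iic x)) (f c) c := by
  obtain ⟨d, had, hdc⟩ := exists_between hc.1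
  have hIcc : ∀ x ∈ Ioo d b, Icc d x ⊆ Ioo a b := fun x hx y hy =>
    ⟨had.trans_le hy.1, hy.2.trans_lt hx.2⟩
  have hcdf : ∀ x ∈ Ioo d b, μ.real (Iic x) = μ.real (Iic d) + ∫ t in d..x, f t := by
    intro x hx
    have hint : IntegrableOn f (Ioc d x) :=
      ((hf.mono (hIcc x hx)).integrableOn_Icc).mono_set Ioc_subset_Icc_self
    have hIoc : μ.real (Ioc d x) = ∫ t in d..x, f t := by
      have h0 : 0 ≤ᵐ[volume.restrict (Ioc d x)] f :=
        (ae_restrict_iff' measurableSet_Ioc).2 (ae_of_all _ fun y hy =>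
          (hf0 y (hIcc x hx (Ioc_subset_Icc_self hy))).le)
      rw [intervalIntegral.integral_of_le hx.1.le, integral_eq_lintegral_of_nonneg_ae h0 hint.1,
        measureReal_def, hμ, withDensity_apply _ measurableSet_Ioc]
    rw [← Iic_union_Ioc_eq_Iic hx.1.le,
      measureReal_union (Set.Iic_disjoint_Ioc le_rfl) measurableSet_Ioc, hIoc]
  have hnhds : Ioo a b ∈ 𝓝 c := isOpen_Ioo.mem_nhds hc
  have hint : IntervalIntegrable f volume d c :=
    (hf.mono (by rw [uIcc_of_le hdc.le]; exact hIcc c ⟨hdc, hc.2⟩)).intervalIntegrable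
  have hderiv : HasDerivAt (fun x => ∫ t in d..x, f t) (f c) c :=
    intervalIntegral.integral_hasDerivAt_right hint
      (hf.stronglyMeasurableAtFilter isOpen_Ioo c hc) (hf.continuousAt hnhds)
  refine (hderiv.const_add (μ.real (Iic d))).congr_of_eventuallyEq ?_
  filter_upwards [isOpen_Ioo.mem_nhds (show c ∈ Ioo d b from ⟨hdc, hc.2⟩)] with x hx
  exact hcdf x hx

/-- A continuously differentiable function with nonzero derivative has a differentiable local
right inverse. -/
theorem exists_hasDerivAt_rightInverse {s s' : ℝ → ℝ} {U : Set ℝ} {c : ℝ} (hU : U ∈ 𝓝 c)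
    (hs : ∀ x ∈ U, HasDerivAt s (s' x) x) (hs' : ContinuousOn s' U) (hc : s' c ≠ 0) :
    ∃ y : ℝ → ℝ, y (s c) = c ∧ HasDerivAt y (s' c)⁻¹ (s c) ∧ ∀ᶠ h in 𝓝 (s c), s (y h) = h := by
  have hstrict : HasStrictDerivAt s (s' c) c :=
    hasStrictDerivAt_of_hasDerivAt_of_continuousAt (mem_of_superset hU hs)
      (hs'.continuousAt hU)
  refine ⟨hstrict.localInverse s (s' c) c hc, ?_, (hstrict.to_localInverse hc).hasDerivAt, ?_⟩
  · exact HasStrictFDerivAt.localInverse_apply_image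
      (hstrict.hasStrictFDerivAt_equiv hc)
  · exact HasStrictFDerivAt.eventually_right_inverse
      (hstrict.hasStrictFDerivAt_equiv hc)

/-- A function whose derivative vanishes nowhere on an open interval is strictly increasing there
if the derivative is positive at one point. -/
theorem strictMonoOn_Ioo_of_hasDerivAt_ne_zero {s s' : ℝ → ℝ} {a b c : ℝ} (hc : c ∈ Ioo a b)
    (hs : ∀ x ∈ Ioo a b, HasDerivAt s (s' x) x) (hne : ∀ x ∈ Ioo a b, s' x ≠ 0)
    (hpos : 0 < s' c) : StrictMonoOn s (Ioo a b) := by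
  have hlt : ∀ x ∈ Ioo a b, 0 < s' x := by
    rcases hasDerivWithinAt_forall_lt_or_forall_gt_of_forall_ne (convex_Ioo a b)
      (fun x hx => (hs x hx).hasDerivWithinAt) hne with h | h
    · exact absurd (h c hc) hpos.not_gt
    · exact h
  refine strictMonoOn_of_deriv_pos (convex_Ioo a b)
    (fun x hx => (hs x hx).continuousAt.continuousWithinAt) fun x hx => ?_
  rw [interior_Ioo] at hx
  rw [(hs x hx).deriv]
  exact hlt x hx

/-- One-sided density of the selection variable at the bunching point: with `X = max (X*, xb)`,
`p = ℙ(X* ≤ xb)` the probability of bunching, `f` the density of `X*` (continuous and positive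
on an open interval `J = (j₁, j₂)` around `xb`), and `s` continuously differentiable on `J`
with `s xb = 0`, `k = s' xb ≠ 0`, sign condition `sgn k · s x < 0` for `x < xb`, and locality
condition via `δ`, the conditional CDF `G t = ℙ(s (X*) ≤ t ∧ X* ≤ xb) / p` has a one-sided
derivative at `0` (from the left if `k > 0`, from the right if `k < 0`) equal to
`g₀ = f xb / (p * |k|)`, and `|s' xb| = (f xb / p) / g₀`. -/
theorem stmt6 {Ω : Type*} [MeasurableSpace Ω] (P : Measure Ω) [IsProbabilityMeasure P]
    (Xstar : Ω → ℝ) (hXstar : Measurable Xstar) (xb : ℝ)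
    (hp : 0 < P {ω | Xstar ω ≤ xb})
    (f : ℝ → ℝ)
    (hdens : Measure.map Xstar P = volume.withDensity fun x => ENNReal.ofReal (f x))
    (j₁ j₂ : ℝ) (hj₁ : j₁ < xb) (hj₂ : xb < j₂)
    (hfc : ContinuousOn f (Set.Ioo j₁ j₂))
    (hfpos : ∀ x ∈ Set.Ioo j₁ j₂, 0 < f x)
    (s s' : ℝ → ℝ) (hs : Measurable s)
    (hdiff : ∀ x ∈ Set.Ioo j₁ j₂, HasDerivAt s (s' x) x)
    (hs'c : ContinuousOn s' (Set.Ioo j₁ j₂))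
    (hsxb : s xb = 0) (hk : s' xb ≠ 0)
    (hs'ne : ∀ x ∈ Set.Ioo j₁ j₂, s' x ≠ 0)
    (hsign : ∀ x < xb, Real.sign (s' xb) * s x < 0)
    (δ : ℝ) (hδ : 0 < δ)
    (hδJ : ∀ x ≤ xb, |s x| < δ → x ∈ Set.Ioo j₁ j₂) :
    (0 < s' xb →
      Tendsto (fun h =>
          ((P {ω | s (Xstar ω) ≤ h ∧ Xstar ω ≤ xb}).toReal / (P {ω | Xstar ω ≤ xb}).toReal -
            (P {ω | s (Xstar ω) ≤ 0 ∧ Xstar ω ≤ xb}).toReal / (P {ω | Xstar ω ≤ xb}).toReal) / h)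
        (𝓝[<] (0 : ℝ)) (𝓝 (f xb / ((P {ω | Xstar ω ≤ xb}).toReal * s' xb)))) ∧
    (s' xb < 0 →
      Tendsto (fun h =>
          ((P {ω | s (Xstar ω) ≤ h ∧ Xstar ω ≤ xb}).toReal / (P {ω | Xstar ω ≤ xb}).toReal -
            (P {ω | s (Xstar ω) ≤ 0 ∧ Xstar ω ≤ xb}).toReal / (P {ω | Xstar ω ≤ xb}).toReal) / h)
        (𝓝[>] (0 : ℝ)) (𝓝 (f xb / ((P {ω | Xstar ω ≤ xb}).toReal * |s' xb|)))) ∧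
    |s' xb| = (f xb / (P {ω | Xstar ω ≤ xb}).toReal) /
      (f xb / ((P {ω | Xstar ω ≤ xb}).toReal * |s' xb|)) := by
  have hxb : xb ∈ Ioo j₁ j₂ := ⟨hj₁, hj₂⟩
  have hJ : Ioo j₁ j₂ ∈ 𝓝 xb := isOpen_Ioo.mem_nhds hxb
  have hfxb := hfpos xb hxb
  set μ := Measure.map Xstar P with hμ
  have hμprob : IsProbabilityMeasure μ := Measure.isProbabilityMeasure_map hXstar.aemeasurable
  have hμatoms : NullSingletonClass μ := by rw [hdens]; infer_instance
  have hlaw : ∀ A : Set ℝ, MeasurableSet A → (P {ω | Xstar ω ∈ A}).toReal = μ.real A := by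
    intro A hA
    rw [measureReal_def, hμ, Measure.map_apply hXstar hA]
    rfl
  have hp0 : 0 < (P {ω | Xstar ω ≤ xb}).toReal := ENNReal.toReal_pos hp.ne' (measure_ne_top _ _)
  set p := (P {ω | Xstar ω ≤ xb}).toReal with hpdef
  obtain ⟨y, hy0, hy, hsy⟩ := exists_hasDerivAt_rightInverse hJ hdiff hs'c hk
  rw [hsxb] at hy0 hy hsy
  have hyJ : ∀ᶠ h in 𝓝 (0 : ℝ), y h ∈ Ioo j₁ j₂ :=
    hy.continuousAt.eventually_mem (by rw [hy0]; exact hJ)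
  have hcdf : HasDerivAt (fun h => μ.real (Iic (y h))) (f xb * (s' xb)⁻¹) 0 := by
    have h := hasDerivAt_real_Iic_of_withDensity hdens hxb hfc hfpos
    rw [← hy0] at h
    simpa [Function.comp_def, hy0] using h.comp 0 hy
  have hslope := hasDerivAt_iff_tendsto_slope.1 hcdf
  refine ⟨fun hpos => ?_, fun hneg => ?_, ?_⟩
  · have hmono := strictMonoOn_Ioo_of_hasDerivAt_ne_zero hxb hdiff hs'ne hpos
    have hsneg : ∀ x < xb, s x < 0 := fun x hx => by
      simpa [Real.sign_of_pos hpos] using hsign x hx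
    have hlim := (hslope.mono_left (nhdsWithin_mono 0 fun h hh => ne_of_lt hh :
      𝓝[<] (0 : ℝ) ≤ 𝓝[≠] 0)).div_const p
    have hzero : (P {ω | s (Xstar ω) ≤ 0 ∧ Xstar ω ≤ xb}).toReal = μ.real (Iic xb) := by
      rw [← hlaw _ measurableSet_Iic]
      congr 2
      ext ω
      refine ⟨fun h => h.2, fun h => ⟨?_, h⟩⟩
      rcases (show Xstar ω ≤ xb from h).lt_or_eq with h | h
      · exact (hsneg _ h).le
      · rw [h, hsxb]
    convert hlim.congr' ?_ using 2
    · field_simp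
    filter_upwards [self_mem_nhdsWithin, nhdsWithin_le_nhds hsy, nhdsWithin_le_nhds hyJ,
      nhdsWithin_le_nhds (Ioi_mem_nhds (neg_lt_zero.2 hδ))] with h hh hsh hyh hhδ
    have hh : h < 0 := hh
    have hhδ : -δ < h := hhδ
    have hyxb : y h < xb := (hmono.lt_iff_lt hyh hxb).1 (by rwa [hsh, hsxb])
    have hset : {ω | s (Xstar ω) ≤ h ∧ Xstar ω ≤ xb} = {ω | Xstar ω ∈ Iic (y h)} := by
      ext ω
      generalize hx : Xstar ω = x
      simp only [mem_ofPred_eq, mem_Iic, hx]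
      constructor
      · rintro ⟨h1, h2⟩
        by_contra! hlt
        have := hmono hyh ⟨hyh.1.trans hlt, h2.trans_lt hj₂⟩ hlt
        linarith
      · intro hle
        refine ⟨?_, hle.trans hyxb.le⟩
        by_contra! hlt
        have h1 := hsneg x (hle.trans_lt hyxb)
        have hxJ := hδJ x (hle.trans hyxb.le) (abs_lt.2 ⟨by linarith, by linarith⟩)
        have := hmono.monotoneOn hxJ hyh hle
        linarith
    rw [hset, hlaw _ measurableSet_Iic, hzero, slope_def_field, hy0]
    ring
  · have hanti : StrictAntiOn s (Ioo j₁ j₂) := by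
      have := strictMonoOn_Ioo_of_hasDerivAt_ne_zero (s := -s) (s' := -s') hxb
        (fun x hx => (hdiff x hx).neg) (fun x hx => neg_ne_zero.2 (hs'ne x hx))
        (by simpa using hneg)
      intro a ha b hb hab
      simpa using this ha hb hab
    have hspos : ∀ x < xb, 0 < s x := fun x hx => by
      simpa [Real.sign_of_neg hneg] using hsign x hx
    have hlim := ((hslope.mono_left (nhdsWithin_mono 0 fun h hh => ne_of_gt hh :
      𝓝[>] (0 : ℝ) ≤ 𝓝[≠] 0)).div_const p).neg
    have hzero : (P {ω | s (Xstar ω) ≤ 0 ∧ Xstar ω ≤ xb}).toReal = 0 := by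
      have hset : {ω | s (Xstar ω) ≤ 0 ∧ Xstar ω ≤ xb} = {ω | Xstar ω ∈ ({xb} : Set ℝ)} := by
        ext ω
        refine ⟨fun h => ?_, fun h => ?_⟩
        · exact (h.2.lt_or_eq).resolve_left fun hlt => (hspos _ hlt).not_ge h.1
        · have h : Xstar ω = xb := h
          simp [h, hsxb]
      rw [hset, hlaw _ (measurableSet_singleton xb)]
      simp [measureReal_def]
    convert hlim.congr' ?_ using 2
    · rw [abs_of_neg hneg]
      field_simp
    filter_upwards [self_mem_nhdsWithin, nhdsWithin_le_nhds hsy, nhdsWithin_le_nhds hyJ,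
      nhdsWithin_le_nhds (Iio_mem_nhds hδ)] with h hh hsh hyh hhδ
    have hh : 0 < h := hh
    have hhδ : h < δ := hhδ
    have hyxb : y h < xb := (hanti.lt_iff_gt hxb hyh).1 (by rwa [hsh, hsxb])
    have hset : {ω | s (Xstar ω) ≤ h ∧ Xstar ω ≤ xb} = {ω | Xstar ω ∈ Icc (y h) xb} := by
      ext ω
      generalize hx : Xstar ω = x
      simp only [mem_ofPred_eq, mem_Icc, hx]
      constructor
      · rintro ⟨h1, h2⟩
        refine ⟨?_, h2⟩
        by_contra! hlt
        have h3 := hspos x (hlt.trans hyxb)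
        have hxJ := hδJ x h2 (abs_lt.2 ⟨by linarith, by linarith⟩)
        have := hanti hxJ hyh hlt
        linarith
      · rintro ⟨h1, h2⟩
        have := hanti.antitoneOn hyh ⟨hyh.1.trans_le h1, h2.trans_lt hj₂⟩ h1
        exact ⟨by linarith, h2⟩
    have hIcc : μ.real (Icc (y h) xb) = μ.real (Iic xb) - μ.real (Iic (y h)) := by
      rw [← measureReal_congr (Ioc_ae_eq_Icc (μ := μ)), ← Iic_union_Ioc_eq_Iic hyxb.le,
        measureReal_union (Set.Iic_disjoint_Ioc le_rfl) measurableSet_Ioc]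
      ring
    rw [hset, hlaw _ measurableSet_Icc, hzero, hIcc, slope_def_field, hy0]
    ring
  · have hk' : 0 < |s' xb| := abs_pos.2 hk
    field_simp
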